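/- arXiv:1302.6702 — 3 statements merged into one kernel-verified Lean document; each statement's English description precedes it below -/
import Mathlib

section
/- Let d,k,e,a,f,m,n be integers with 1 ≤ d ≤ k, 1 ≤ a ≤ k, 1 ≤ f ≤ d, 1 ≤ e ≤ d, m,n ≥ 0. Then {}_db_{dk+e,da+f}(m,n) − {}_db_{dk+e,da+f−1}(m,n) = {}_db̄_{dk+e,dk−da+d}(m−(da+f−1), n−m) if f ≤ e, and {}_db_{dk+e,da+f}(m,n) − {}_db_{dk+e,da+f−1}(m,n) = {}_db̄_{dk+e,dk−da}(m−(da+f−1), n−m) if f > e, where counts with any negative argument are zero. -/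
/-- The condition defining `ₑb_{K,s}`-partitions: `f_i + f_{i+1} < K` for all `i ≥ 1`,
`f₁ < s`, and `d ∣ f_{2i}` for all `i ≥ 1`, where `f_i` is the number of parts equal to `i`. -/
def EvenDivCond (d K s : ℕ) {n : ℕ} (p : n.Partition) : Prop :=
  (∀ i : ℕ, 1 ≤ i → p.parts.count i + p.parts.count (i + 1) < K) ∧
  p.parts.count 1 < s ∧
  (∀ i : ℕ, 1 ≤ i → d ∣ p.parts.count (2 * i))

/-- The condition defining `ₑb̄_{K,s}`-partitions: `f_i + f_{i+1} < K` for all `i ≥ 1`,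
`f₁ < s`, and `d ∣ f_{2i+1}` for all `i ≥ 0`. -/
def OddDivCond (d K s : ℕ) {n : ℕ} (p : n.Partition) : Prop :=
  (∀ i : ℕ, 1 ≤ i → p.parts.count i + p.parts.count (i + 1) < K) ∧
  p.parts.count 1 < s ∧
  (∀ i : ℕ, d ∣ p.parts.count (2 * i + 1))

/-- `ₑb_{K,s}(m,n)` for integer arguments: the number of partitions of `n` into exactly `m`
parts satisfying `EvenDivCond d K s`; it is `0` whenever `m < 0` or `n < 0`. -/
noncomputable def bZ (d K s : ℕ) (m n : ℤ) : ℕ :=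
  if 0 ≤ n then
    Nat.card {p : Nat.Partition n.toNat // (p.parts.card : ℤ) = m ∧ EvenDivCond d K s p}
  else 0

/-- `ₑb̄_{K,s}(m,n)` for integer arguments: the number of partitions of `n` into exactly `m`
parts satisfying `OddDivCond d K s`; it is `0` whenever `m < 0` or `n < 0`. -/
noncomputable def bbarZ (d K s : ℕ) (m n : ℤ) : ℕ :=
  if 0 ≤ n then
    Nat.card {p : Nat.Partition n.toNat // (p.parts.card : ℤ) = m ∧ OddDivCond d K s p}
  else 0

/-- The shift `f_i ↦ f_{i+1}` turns the even divisibility condition, with exactly `t` parts equal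
to `1`, into the odd one. -/
theorem evenDivCond_iff_oddDivCond {d K s t n n' : ℕ}
    (hs : ∀ g, d ∣ g → (t + g < K ↔ g < s)) (p : n.Partition) (q : n'.Partition)
    (h : p.parts = q.parts.map (· + 1) + Multiset.replicate t 1) :
    EvenDivCond d K (t + 1) p ↔ OddDivCond d K s q := by
  have h_zero : q.parts.count 0 = 0 :=
    Multiset.count_eq_zero.2 fun h0 => absurd (q.parts_pos h0) (lt_irrefl 0)
  have h_map (i : ℕ) : (q.parts.map (· + 1)).count (i + 1) = q.parts.count i :=
    Multiset.count_map_eq_count' _ _ (add_left_injective 1) i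
  have h_one : p.parts.count 1 = t := by
    rw [h, Multiset.count_add, h_map 0, h_zero, Multiset.count_replicate_self, zero_add]
  have h_succ (i : ℕ) (hi : 1 ≤ i) : p.parts.count (i + 1) = q.parts.count i := by
    rw [h, Multiset.count_add, h_map i, Multiset.count_replicate, if_neg (by omega), add_zero]
  constructor
  · rintro ⟨h_sum, -, h_dvd⟩
    have h_odd (i : ℕ) : d ∣ q.parts.count (2 * i + 1) := by
      rw [← h_succ _ (by omega)]
      exact h_dvd (i + 1) (by omega)
    refine ⟨fun i hi => ?_, (hs _ (h_odd 0)).1 ?_, h_odd⟩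
    · rw [← h_succ i hi, ← h_succ (i + 1) (by omega)]
      exact h_sum (i + 1) (by omega)
    · have := h_sum 1 le_rfl
      rwa [h_one, h_succ 1 le_rfl] at this
  · rintro ⟨h_sum, h_lt, h_dvd⟩
    refine ⟨fun i hi => ?_, by omega, fun i hi => ?_⟩
    · obtain rfl | hi := hi.eq_or_lt
      · rw [h_one, h_succ 1 le_rfl]
        exact (hs _ (h_dvd 0)).2 h_lt
      · obtain ⟨j, rfl⟩ : ∃ j, i = j + 1 := ⟨i - 1, by omega⟩
        rw [h_succ j (by omega), h_succ (j + 1) (by omega)]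
        exact h_sum j (by omega)
    · obtain ⟨j, rfl⟩ : ∃ j, i = j + 1 := ⟨i - 1, by omega⟩
      rw [show 2 * (j + 1) = 2 * j + 1 + 1 by ring, h_succ _ (by omega)]
      exact h_dvd j

/-- Every multiset of positive integers arises from another one by adding `1` to all elements and
adjoining copies of `1`. -/
theorem exists_eq_map_succ_add_replicate (P : Multiset ℕ) (hP : ∀ x ∈ P, 0 < x) :
    ∃ Q : Multiset ℕ, (∀ x ∈ Q, 0 < x) ∧
      P = Q.map (· + 1) + Multiset.replicate (P.count 1) 1 := by
  refine ⟨(P.filter (¬ · = 1)).map (· - 1), fun x hx => ?_, ?_⟩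
  · obtain ⟨y, hy, rfl⟩ := Multiset.mem_map.1 hx
    obtain ⟨hyP, hy1⟩ := Multiset.mem_filter.1 hy
    have := hP y hyP
    omega
  · rw [Multiset.map_map, Multiset.map_congr rfl (g := id), Multiset.map_id,
      ← Multiset.filter_eq', add_comm, Multiset.filter_add_not]
    intro y hy
    have := hP y (Multiset.mem_filter.1 hy).1
    simp only [Function.comp_apply, id_eq]
    omega

theorem card_evenDivCond_count_one_eq {d K s t M N : ℕ}
    (hs : ∀ g, d ∣ g → (t + g < K ↔ g < s)) (hMN : M ≤ N) :
    Nat.card {p : N.Partition //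
        (p.parts.card = M ∧ EvenDivCond d K (t + 1) p) ∧ p.parts.count 1 = t} =
      Nat.card {q : (N - M).Partition // q.parts.card + t = M ∧ OddDivCond d K s q} := by
  symm
  let shift (q : {q : (N - M).Partition // q.parts.card + t = M ∧ OddDivCond d K s q}) :
      N.Partition :=
    { parts := q.1.parts.map (· + 1) + Multiset.replicate t 1
      parts_pos := by
        intro i hi
        rcases Multiset.mem_add.1 hi with hi | hi
        · obtain ⟨y, -, rfl⟩ := Multiset.mem_map.1 hi
          omega
        · rw [Multiset.eq_of_mem_replicate hi]
          exact one_pos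
      parts_sum := by
        have h_card := q.2.1
        have h_sum := q.1.parts_sum
        simp only [Multiset.sum_add, Multiset.sum_map_add, Multiset.map_id', Multiset.map_const',
          Multiset.sum_replicate, smul_eq_mul, mul_one]
        omega }
  have h_one (q) : (shift q).parts.count 1 = t := by
    have h0 : 0 ∉ q.1.parts := fun h0 => absurd (q.1.parts_pos h0) (lt_irrefl 0)
    simp [shift, h0]
  refine Nat.card_eq_of_bijective (fun q => ⟨shift q, ⟨?_, ?_⟩, h_one q⟩) ⟨?_, ?_⟩
  · simpa [shift] using q.2.1
  · exact (evenDivCond_iff_oddDivCond hs (shift q) q.1 rfl).2 q.2.2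
  · intro q q' h
    have h_parts : (shift q).parts = (shift q').parts :=
      congrArg Nat.Partition.parts (congrArg Subtype.val h)
    exact Subtype.ext <| Nat.Partition.ext <|
      Multiset.map_injective (add_left_injective 1) (add_right_cancel h_parts)
  · rintro ⟨p, ⟨h_card, h_even⟩, h_count⟩
    obtain ⟨Q, hQ, h_eq⟩ := exists_eq_map_succ_add_replicate p.parts fun _ hx => p.parts_pos hx
    rw [h_count] at h_eq
    have h_card' : Q.card + t = M := by
      rw [← h_card, h_eq]
      simp
    have h_sum : Q.sum = N - M := by
      have := p.parts_sum
      rw [h_eq] at this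
      simp only [Multiset.sum_add, Multiset.sum_map_add, Multiset.map_id', Multiset.map_const',
        Multiset.sum_replicate, smul_eq_mul, mul_one] at this
      omega
    let q : (N - M).Partition := ⟨Q, fun {_} hx => hQ _ hx, h_sum⟩
    exact ⟨⟨q, h_card', (evenDivCond_iff_oddDivCond hs p q h_eq).1 h_even⟩,
      Subtype.ext <| Nat.Partition.ext h_eq.symm⟩

theorem card_evenDivCond_succ (d K t M N : ℕ) :
    Nat.card {p : N.Partition // p.parts.card = M ∧ EvenDivCond d K (t + 1) p} =
      Nat.card {p : N.Partition // p.parts.card = M ∧ EvenDivCond d K t p} +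
      Nat.card {p : N.Partition //
        (p.parts.card = M ∧ EvenDivCond d K (t + 1) p) ∧ p.parts.count 1 = t} := by
  classical
  simp only [Nat.card_eq_fintype_card, Fintype.card_subtype]
  rw [← Finset.card_filter_add_card_filter_not (fun p : N.Partition => p.parts.count 1 = t),
    Finset.filter_filter, Finset.filter_filter, add_comm]
  congr 1
  refine congrArg Finset.card (Finset.ext fun p => ?_)
  rw [Finset.mem_filter, Finset.mem_filter]
  simp only [Finset.mem_univ, true_and, EvenDivCond]
  constructor
  · rintro ⟨⟨h_card, h_sum, h_lt, h_dvd⟩, h_ne⟩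
    exact ⟨h_card, h_sum, by omega, h_dvd⟩
  · rintro ⟨h_card, h_sum, h_lt, h_dvd⟩
    exact ⟨⟨h_card, h_sum, by omega, h_dvd⟩, by omega⟩

theorem card_parts_le {N : ℕ} (p : N.Partition) : p.parts.card ≤ N := by
  conv_rhs => rw [← p.parts_sum]
  simpa using Multiset.card_nsmul_le_sum (s := p.parts) (a := 1) fun _ hx => p.parts_pos hx

theorem bZ_succ_sub_bZ {d K s t : ℕ} (hs : ∀ g, d ∣ g → (t + g < K ↔ g < s)) {m n : ℤ}
    (hm : 0 ≤ m) (hn : 0 ≤ n) :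
    (bZ d K (t + 1) m n : ℤ) - (bZ d K t m n : ℤ) = (bbarZ d K s (m - (t : ℤ)) (n - m) : ℤ) := by
  lift m to ℕ using hm
  lift n to ℕ using hn
  simp only [bZ, bbarZ, Nat.cast_nonneg, if_true, Int.toNat_natCast, Nat.cast_inj, sub_nonneg,
    Nat.cast_le, eq_sub_iff_add_eq, ← Nat.cast_add]
  rw [card_evenDivCond_succ, Nat.cast_add, add_sub_cancel_left, Nat.cast_inj]
  split_ifs with hmn
  · rw [Int.toNat_sub]
    exact card_evenDivCond_count_one_eq hs hmn
  · have : IsEmpty {p : n.Partition //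
        (p.parts.card = m ∧ EvenDivCond d K (t + 1) p) ∧ p.parts.count 1 = t} :=
      ⟨fun p => hmn (p.2.1.1 ▸ card_parts_le p.1)⟩
    exact Nat.card_of_isEmpty

theorem count_recurrence_even_to_odd
    (d k e a f : ℕ) (hd : 1 ≤ d) (hdk : d ≤ k) (ha : 1 ≤ a) (hak : a ≤ k)
    (hf : 1 ≤ f) (hfd : f ≤ d) (he : 1 ≤ e) (hed : e ≤ d)
    (m n : ℤ) (hm : 0 ≤ m) (hn : 0 ≤ n) :
    (f ≤ e →
      (bZ d (d * k + e) (d * a + f) m n : ℤ) - (bZ d (d * k + e) (d * a + f - 1) m n : ℤ) =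
        (bbarZ d (d * k + e) (d * k - d * a + d)
          (m - ((d * a + f - 1 : ℕ) : ℤ)) (n - m) : ℤ)) ∧
    (e < f →
      (bZ d (d * k + e) (d * a + f) m n : ℤ) - (bZ d (d * k + e) (d * a + f - 1) m n : ℤ) =
        (bbarZ d (d * k + e) (d * k - d * a)
          (m - ((d * a + f - 1 : ℕ) : ℤ)) (n - m) : ℤ)) := by
  obtain ⟨c, rfl⟩ := Nat.exists_eq_add_of_le hak
  have h_succ : d * a + f = (d * a + f - 1) + 1 := by omega
  have h_sub : d * (a + c) - d * a = d * c := by rw [mul_add, Nat.add_sub_cancel_left]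
  have h_mul : d * (a + c) = d * a + d * c := mul_add d a c
  constructor <;> intro hfe <;> nth_rw 1 [h_succ] <;> refine bZ_succ_sub_bZ ?_ hm hn <;>
    rintro _ ⟨g, rfl⟩ <;> rw [h_sub, h_mul]
  · rcases le_or_gt g c with h | h
    · have := Nat.mul_le_mul_left d h
      omega
    · have := Nat.mul_le_mul_left d (Nat.succ_le_of_lt h)
      rw [Nat.mul_succ] at this
      omega
  · rcases le_or_gt c g with h | h
    · have := Nat.mul_le_mul_left d h
      omega
    · have := Nat.mul_le_mul_left d (Nat.succ_le_of_lt h)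
      rw [Nat.mul_succ] at this
      omega
end

section
/- Let d,k,e,a,m,n be integers with 1 ≤ d ≤ k, 0 ≤ a ≤ k, 1 ≤ e ≤ d, m,n ≥ 0. Then {}_db̄_{dk+e,da+d}(m,n) − {}_db̄_{dk+e,da}(m,n) = {}_db_{dk+e,dk−da+e}(m−da, n−m), where counts with any negative argument are zero. -/
/-- Increase every element of `t` by one and adjoin `c` ones. -/
def Multiset.raise (c : ℕ) (t : Multiset ℕ) : Multiset ℕ :=
  t.map (· + 1) + Multiset.replicate c 1

namespace Multiset

theorem raise_injective (c : ℕ) : Function.Injective (raise c) := fun _ _ h =>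
  map_injective (add_left_injective 1) (add_right_cancel h)

theorem card_raise (c : ℕ) (t : Multiset ℕ) : (raise c t).card = t.card + c := by
  simp [raise]

theorem sum_raise (c : ℕ) (t : Multiset ℕ) : (raise c t).sum = t.sum + t.card + c := by
  simp [raise, sum_map_add]

theorem count_raise (c : ℕ) (t : Multiset ℕ) (i : ℕ) :
    (raise c t).count (i + 1) = t.count i + if i = 0 then c else 0 := by
  rw [raise, count_add, count_map_eq_count' _ _ (add_left_injective 1), count_replicate]
  simp

theorem zero_notMem_raise (c : ℕ) (t : Multiset ℕ) : 0 ∉ raise c t := by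
  simp [raise, mem_replicate]

theorem exists_raise_eq {s : Multiset ℕ} (hs : 0 ∉ s) :
    ∃ t, 0 ∉ t ∧ raise (s.count 1) t = s := by
  refine ⟨(s.filter (· ≠ 1)).map (· - 1), ?_, ?_⟩
  · simp only [mem_map, mem_filter, not_exists, not_and]
    rintro x ⟨hx, h1⟩ h0
    have : x ≠ 0 := fun h => hs (h ▸ hx)
    omega
  · have h : ((s.filter (· ≠ 1)).map (· - 1)).map (· + 1) = s.filter (· ≠ 1) := by
      rw [map_map]
      conv_rhs => rw [← map_id (s.filter (· ≠ 1))]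
      refine map_congr rfl fun x hx => ?_
      have : x ≠ 0 := fun h => hs (h ▸ mem_of_mem_filter hx)
      simp only [Function.comp_apply, id]
      omega
    rw [raise, h, ← filter_eq', add_comm, filter_add_not]

end Multiset

theorem Nat.Partition.zero_notMem_parts {n : ℕ} (p : n.Partition) : 0 ∉ p.parts :=
  fun h => lt_irrefl 0 (p.parts_pos h)

theorem oddDivCond_of_raise {d K a n N : ℕ} (hd : 1 ≤ d) (p : N.Partition) (q : n.Partition)
    (h : q.parts.raise (d * a) = p.parts) :
    OddDivCond d K (d * a + d) p ↔ EvenDivCond d K (K - d * a) q := by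
  have h0 : q.parts.count 0 = 0 := Multiset.count_eq_zero.2 q.zero_notMem_parts
  have h1 : p.parts.count 1 = d * a := by
    rw [← h, show (1 : ℕ) = 0 + 1 from rfl, Multiset.count_raise, h0]; simp
  have hi (i : ℕ) (hi : 1 ≤ i) : p.parts.count (i + 1) = q.parts.count i := by
    rw [← h, Multiset.count_raise, if_neg (by omega), add_zero]
  constructor
  · rintro ⟨hK, -, hdiv⟩
    refine ⟨fun i h => ?_, ?_, fun i h => ?_⟩
    · have := hK (i + 1) (by omega)
      rwa [hi i h, hi (i + 1) (by omega)] at this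
    · have := hK 1 le_rfl
      rw [hi 1 le_rfl] at this
      omega
    · have := hdiv i
      rwa [hi _ (by omega)] at this
  · rintro ⟨hK, hs, hdiv⟩
    refine ⟨fun i h => ?_, by omega, fun i => ?_⟩
    · obtain rfl | h : i = 1 ∨ 2 ≤ i := by omega
      · rw [hi 1 le_rfl]
        omega
      · obtain ⟨i, rfl⟩ := Nat.exists_eq_add_of_le' (show 1 ≤ i by omega)
        rw [hi i (by omega), hi (i + 1) (by omega)]
        exact hK i (by omega)
    · rcases Nat.eq_zero_or_pos i with rfl | h
      · simp [h1]
      · rw [hi _ (by omega)]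
        exact hdiv i h

theorem card_oddDivCond_count_one_eq {d K a : ℕ} (hd : 1 ≤ d) (n m : ℕ) :
    Nat.card {p : (n + m).Partition //
      (p.parts.card : ℤ) = m ∧ OddDivCond d K (d * a + d) p ∧ p.parts.count 1 = d * a} =
    Nat.card {q : n.Partition //
      (q.parts.card : ℤ) = m - (d * a : ℕ) ∧ EvenDivCond d K (K - d * a) q} := by
  symm
  refine Nat.card_eq_of_bijective (fun q => ⟨⟨q.1.parts.raise (d * a), ?_, ?_⟩, ?_, ?_, ?_⟩)
    ⟨?_, ?_⟩
  · exact fun {i} hi => Nat.pos_of_ne_zero fun h => Multiset.zero_notMem_raise _ _ (h ▸ hi)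
  · have := q.2.1
    rw [Multiset.sum_raise, q.1.parts_sum]
    omega
  · have := q.2.1
    simp only [Multiset.card_raise]
    omega
  · exact (oddDivCond_of_raise hd _ q.1 rfl).2 q.2.2
  · change Multiset.count (0 + 1) _ = _
    rw [Multiset.count_raise, Multiset.count_eq_zero.2 q.1.zero_notMem_parts]
    simp
  · intro q q' h
    simp only [Subtype.mk.injEq, Nat.Partition.mk.injEq] at h
    exact Subtype.ext (Nat.Partition.ext (Multiset.raise_injective _ h))
  · rintro ⟨p, hm, hp, h1⟩
    obtain ⟨t, ht, htp⟩ := Multiset.exists_raise_eq p.zero_notMem_parts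
    rw [h1] at htp
    have hcard := congrArg Multiset.card htp
    have hsum := congrArg Multiset.sum htp
    rw [Multiset.card_raise] at hcard
    rw [Multiset.sum_raise, p.parts_sum] at hsum
    let q : n.Partition :=
      ⟨t, fun {i} hi => Nat.pos_of_ne_zero fun h => ht (h ▸ hi), by omega⟩
    refine ⟨⟨q, ?_, (oddDivCond_of_raise hd p q htp).1 hp⟩, ?_⟩
    · change (t.card : ℤ) = _
      omega
    · exact Subtype.ext (Nat.Partition.ext htp)

theorem Nat.Partition.card_parts_le {n : ℕ} (p : n.Partition) : p.parts.card ≤ n := by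
  have := Multiset.card_nsmul_le_sum (s := p.parts) (a := 1) fun x hx => p.parts_pos hx
  simpa [p.parts_sum] using this

theorem oddDivCond_add_iff {d K a n : ℕ} (hd : 1 ≤ d) (p : n.Partition) :
    OddDivCond d K (d * a + d) p ↔
      OddDivCond d K (d * a) p ∨ (OddDivCond d K (d * a + d) p ∧ p.parts.count 1 = d * a) := by
  constructor
  · intro h
    obtain ⟨hK, hs, hdiv⟩ := h
    rcases lt_or_ge (p.parts.count 1) (d * a) with hlt | hge
    · exact .inl ⟨hK, hlt, hdiv⟩
    · refine .inr ⟨⟨hK, hs, hdiv⟩, ?_⟩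
      obtain ⟨c, hc⟩ := hdiv 0
      rw [mul_zero, zero_add] at hc
      rw [hc] at hs hge ⊢
      have h1 : c < a + 1 := Nat.lt_of_mul_lt_mul_left (a := d) (by rwa [mul_add_one])
      have h2 : a ≤ c := Nat.le_of_mul_le_mul_left hge hd
      rw [show c = a by omega]
  · rintro (⟨hK, hs, hdiv⟩ | h)
    · exact ⟨hK, by omega, hdiv⟩
    · exact h.1

theorem card_oddDivCond_add {d K a n : ℕ} (hd : 1 ≤ d) (m : ℤ) :
    Nat.card {p : n.Partition // (p.parts.card : ℤ) = m ∧ OddDivCond d K (d * a + d) p} =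
      Nat.card {p : n.Partition // (p.parts.card : ℤ) = m ∧ OddDivCond d K (d * a) p} +
      Nat.card {p : n.Partition //
        (p.parts.card : ℤ) = m ∧ OddDivCond d K (d * a + d) p ∧ p.parts.count 1 = d * a} := by
  classical
  simp only [Nat.card_eq_fintype_card, Fintype.card_subtype]
  rw [← Finset.card_union_of_disjoint]
  · congr 1
    ext p
    simp only [Finset.mem_filter, Finset.mem_union, Finset.mem_univ, true_and, ← and_or_left]
    rw [← oddDivCond_add_iff hd p]
  · rw [Finset.disjoint_filter]
    rintro p - ⟨-, -, h, -⟩ ⟨-, -, h'⟩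
    omega

theorem count_recurrence_odd_to_even
    (d k e a : ℕ) (hd : 1 ≤ d) (hdk : d ≤ k) (hak : a ≤ k)
    (he : 1 ≤ e) (hed : e ≤ d)
    (m n : ℤ) (hm : 0 ≤ m) (hn : 0 ≤ n) :
    (bbarZ d (d * k + e) (d * a + d) m n : ℤ) - (bbarZ d (d * k + e) (d * a) m n : ℤ) =
      (bZ d (d * k + e) (d * k - d * a + e) (m - ((d * a : ℕ) : ℤ)) (n - m) : ℤ) := by
  lift m to ℕ using hm
  lift n to ℕ using hn
  have hda : d * a ≤ d * k := Nat.mul_le_mul_left d hak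
  rw [← Nat.sub_add_comm hda, bbarZ, bbarZ, if_pos (by omega), if_pos (by omega),
    card_oddDivCond_add hd, Nat.cast_add, add_sub_cancel_left, Nat.cast_inj, Int.toNat_natCast, bZ]
  split_ifs with h
  · obtain ⟨N, rfl⟩ := Nat.exists_eq_add_of_le' (show m ≤ n by omega)
    rw [card_oddDivCond_count_one_eq hd, show ((N + m : ℕ) - m : ℤ).toNat = N by omega]
  · rw [Nat.card_eq_zero]
    refine .inl ⟨fun p => ?_⟩
    have := p.1.card_parts_le
    have := p.2.1
    omega
end

section
/- (First Rogers–Ramanujan identity, combinatorial form.) For every non-negative integer n, the number A(n) of partitions of n all of whose parts are ≢ 0, 2, 3 (mod 5) (equivalently, ≢ 0, ±2 (mod 5)) equals the number B(n) of partitions of n into distinct parts no two of which are consecutive integers (equivalently, partitions whose frequencies satisfy f_i + f_{i+1} ≤ 1 for all i ≥ 1). -/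
open Finset

namespace RogersRamanujan

section QSeries

variable {R : Type*} [CommRing R]

/-- The `q`-Pochhammer symbol `(q; q)_n`. -/
def qFac (q : R) (n : ℕ) : R := ∏ i ∈ range n, (1 - q ^ (i + 1))

/-- The inverse `1 / (q; q)_n`, meaningful when `q` is nilpotent. -/
noncomputable def qInv (q : R) (n : ℕ) : R := Ring.inverse (qFac q n)

lemma isUnit_one_sub_pow {q : R} (hq : IsNilpotent q) (n : ℕ) : IsUnit (1 - q ^ (n + 1)) :=
  (hq.pow_succ n).isUnit_one_sub

lemma isUnit_qFac {q : R} (hq : IsNilpotent q) (n : ℕ) : IsUnit (qFac q n) := by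
  unfold qFac
  induction n with
  | zero => simp
  | succ n ih => rw [prod_range_succ]; exact ih.mul (isUnit_one_sub_pow hq n)

lemma qInv_mul_qFac {q : R} (hq : IsNilpotent q) (n : ℕ) : qInv q n * qFac q n = 1 :=
  Ring.inverse_mul_cancel _ (isUnit_qFac hq n)

@[simp] lemma qInv_zero (q : R) : qInv q 0 = 1 := by simp [qInv, qFac]

lemma qInv_eq_mul_qInv_succ {q : R} (hq : IsNilpotent q) (n : ℕ) :
    qInv q n = (1 - q ^ (n + 1)) * qInv q (n + 1) := by
  apply (isUnit_qFac hq (n + 1)).mul_right_cancel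
  rw [mul_assoc, qInv_mul_qFac hq, qFac, prod_range_succ, ← qFac, ← mul_assoc, qInv_mul_qFac hq]
  ring

/-- Summed form of the `q`-Pascal rule `[n+1, k] = q ^ k [n, k] + [n, k-1]`. -/
lemma qPascal_sum {q : R} (hq : IsNilpotent q) (n : ℕ) (e : ℕ → R) :
    (1 - q ^ (n + 1)) * ∑ k ∈ range (n + 2), qInv q k * qInv q (n + 1 - k) * e k =
      ∑ k ∈ range (n + 1), qInv q k * qInv q (n - k) * (q ^ k * e k + e (k + 1)) := by
  have h1 : (1 - q ^ (n + 1)) * ∑ k ∈ range (n + 2), qInv q k * qInv q (n + 1 - k) * e k =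
      ∑ k ∈ range (n + 2), q ^ k * (1 - q ^ (n + 1 - k)) * (qInv q k * qInv q (n + 1 - k) * e k) +
      ∑ k ∈ range (n + 2), (1 - q ^ k) * (qInv q k * qInv q (n + 1 - k) * e k) := by
    rw [mul_sum, ← sum_add_distrib]
    refine sum_congr rfl fun k hk => ?_
    have hk' : q ^ (n + 1) = q ^ k * q ^ (n + 1 - k) := by
      rw [← pow_add]; congr 1; have := mem_range.1 hk; omega
    rw [hk']; ring
  rw [h1, sum_range_succ, sum_range_succ' (fun k => (1 - q ^ k) * _)]
  simp only [Nat.sub_self, pow_zero, sub_self, mul_zero, zero_mul, add_zero]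
  rw [← sum_add_distrib]
  refine sum_congr rfl fun k hk => ?_
  have hk := mem_range.1 hk
  have h2 : n + 1 - k = (n - k) + 1 := by omega
  rw [Nat.add_sub_add_right, h2]
  linear_combination (-(q ^ k * qInv q k * e k)) * qInv_eq_mul_qInv_succ hq (n - k) -
    qInv q (n - k) * e (k + 1) * qInv_eq_mul_qInv_succ hq k

/-- Summed form of the `q`-Pascal rule `[n+1, k] = [n, k] + q ^ (n+1-k) [n, k-1]`. -/
lemma qPascal_sum' {q : R} (hq : IsNilpotent q) (n : ℕ) (e : ℕ → R) :
    (1 - q ^ (n + 1)) * ∑ k ∈ range (n + 2), qInv q k * qInv q (n + 1 - k) * e k =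
      ∑ k ∈ range (n + 1), qInv q k * qInv q (n - k) * (e k + q ^ (n - k) * e (k + 1)) := by
  have h := qPascal_sum hq n (fun k => e (n + 1 - k))
  rw [← sum_range_reflect, ← sum_range_reflect (n := n + 1)] at h
  convert h using 2
  · refine sum_congr rfl fun k hk => ?_
    have hk := mem_range.1 hk
    have h1 : n + 2 - 1 - k = n + 1 - k := by omega
    have h2 : n + 1 - (n + 1 - k) = k := by omega
    rw [h1, h2]; ring
  · rename_i k hk
    have hk := mem_range.1 hk
    have h1 : n + 1 - 1 - k = n - k := by omega
    have h2 : n - (n - k) = k := by omega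
    have h3 : n + 1 - (n - k) = k + 1 := by omega
    have h4 : n + 1 - (n - k + 1) = k := by omega
    rw [h1, h2, h3, h4]; ring

/-- A form of the `q`-Chu–Vandermonde sum. -/
lemma sum_qInv_vandermonde {q : R} (hq : IsNilpotent q) (n c : ℕ) :
    ∑ r ∈ range (n + 1), qInv q r * qInv q (n - r) * (q ^ (r * (r + c)) * qInv q (r + c)) =
      qInv q n * qInv q (n + c) := by
  induction n generalizing c with
  | zero => simp
  | succ n ih =>
    apply (isUnit_one_sub_pow hq n).mul_left_cancel
    rw [qPascal_sum hq, ← mul_assoc, ← qInv_eq_mul_qInv_succ hq,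
      show n + 1 + c = n + (c + 1) by ring, ← ih (c + 1)]
    refine sum_congr rfl fun r _ => ?_
    rw [show r + 1 + c = r + c + 1 by ring, show r + (c + 1) = r + c + 1 by ring,
      qInv_eq_mul_qInv_succ hq (r + c)]
    ring

/-- The Bailey lemma in the limiting form that multiplies `α r` by `q ^ (r ^ 2)`. -/
lemma bailey_step {q : R} (hq : IsNilpotent q) {α β : ℕ → R}
    (h : ∀ n, β n = ∑ r ∈ range (n + 1), qInv q (n - r) * qInv q (n + r) * α r) (n : ℕ) :
    ∑ s ∈ range (n + 1), q ^ (s ^ 2) * qInv q (n - s) * β s =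
      ∑ r ∈ range (n + 1), qInv q (n - r) * qInv q (n + r) * (q ^ (r ^ 2) * α r) := by
  simp only [h, mul_sum]
  rw [sum_comm' (t' := range (n + 1)) (s' := fun r => Ico r (n + 1))
    (by simp only [mem_range, mem_Ico]; omega)]
  refine sum_congr rfl fun r hr => ?_
  obtain ⟨d, rfl⟩ := Nat.exists_eq_add_of_le (Nat.lt_succ_iff.1 (mem_range.1 hr))
  have key := sum_qInv_vandermonde hq d (2 * r)
  rw [sum_Ico_eq_sum_range, show r + d + 1 - r = d + 1 by omega, show r + d - r = d by omega,
    show r + d + r = d + 2 * r by ring, ← key, sum_mul]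
  refine sum_congr rfl fun t _ => ?_
  rw [show r + t - r = t by omega, show r + d - (r + t) = d - t by omega,
    show r + t + r = t + 2 * r by ring]
  ring

/-- The terms `z ^ j * y ^ (j (j - 1) / 2)` for `j = k - n`, where `z = a` and `z⁻¹ * y = b`. -/
def thetaTerm (a b y : R) (n k : ℕ) : R :=
  if n ≤ k then a ^ (k - n) * y ^ (k - n).choose 2 else b ^ (n - k) * y ^ (n - k).choose 2

lemma choose_two_succ (n : ℕ) : (n + 1).choose 2 = n + n.choose 2 := by
  rw [Nat.choose_succ_succ' n 1, Nat.choose_one_right]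

lemma thetaTerm_succ {a b y : R} (hab : a * b = y) {m n k : ℕ} (hk : k ≤ m + n) :
    y ^ (m + n - k) * thetaTerm a b y n (k + 1) = a * y ^ m * thetaTerm a b y n k := by
  unfold thetaTerm
  rcases le_or_gt n k with h | h
  · obtain ⟨d, rfl⟩ := Nat.exists_eq_add_of_le h
    obtain ⟨e, rfl⟩ : ∃ e, m = d + e := Nat.exists_eq_add_of_le (by omega)
    rw [if_pos (by omega), if_pos h, show n + d + 1 - n = d + 1 by omega,
      show n + d - n = d by omega, show d + e + n - (n + d) = e by omega, choose_two_succ]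
    ring
  · obtain ⟨d, rfl⟩ := Nat.exists_eq_add_of_lt h
    rw [if_neg (by omega : ¬ k + d + 1 ≤ k), show k + d + 1 - k = d + 1 by omega,
      show m + (k + d + 1) - k = m + d + 1 by omega]
    rcases d with _ | d
    · simp [← hab]; ring
    · rw [if_neg (by omega), show k + (d + 1) + 1 - (k + 1) = d + 1 by omega,
        choose_two_succ (d + 1)]
      have : y ^ (m + (d + 1) + 1) = a * b * y ^ (m + (d + 1)) := by rw [hab]; ring
      rw [this]; ring

/-- A finite form of the Jacobi triple product identity. -/
lemma finite_triple_product {a b y : R} (hy : IsNilpotent y) (hab : a * b = y) (m n : ℕ) :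
    ∑ k ∈ range (m + n + 1), qInv y k * qInv y (m + n - k) * thetaTerm a b y n k =
      qInv y (m + n) * ((∏ i ∈ range m, (1 + a * y ^ i)) * ∏ i ∈ range n, (1 + b * y ^ i)) := by
  induction m with
  | zero =>
    simp only [zero_add, range_zero, prod_empty, one_mul]
    induction n with
    | zero => simp [thetaTerm]
    | succ n ih =>
      apply (isUnit_one_sub_pow hy n).mul_left_cancel
      rw [qPascal_sum hy, ← mul_assoc, ← qInv_eq_mul_qInv_succ hy, prod_range_succ, ← mul_assoc,
        ← ih, sum_mul]
      refine sum_congr rfl fun k hk => ?_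
      obtain ⟨d, rfl⟩ := Nat.exists_eq_add_of_le (Nat.lt_succ_iff.1 (mem_range.1 hk))
      have h1 : thetaTerm a b y (k + d + 1) (k + 1) = thetaTerm a b y (k + d) k := by
        simp [thetaTerm]
      have h2 : y ^ k * thetaTerm a b y (k + d + 1) k =
          b * y ^ (k + d) * thetaTerm a b y (k + d) k := by
        rcases d with _ | d
        · simp [thetaTerm]; ring
        · simp only [thetaTerm]
          rw [if_neg (by omega), if_neg (by omega), show k + (d + 1) + 1 - k = d + 1 + 1 by omega,
            show k + (d + 1) - k = d + 1 by omega, choose_two_succ (d + 1)]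
          ring
      rw [h1, h2]; ring
  | succ m ih =>
    apply (isUnit_one_sub_pow hy (m + n)).mul_left_cancel
    rw [show m + 1 + n = m + n + 1 by ring, qPascal_sum' hy, ← mul_assoc,
      ← qInv_eq_mul_qInv_succ hy, prod_range_succ]
    trans (1 + a * y ^ m) * ∑ k ∈ range (m + n + 1),
      qInv y k * qInv y (m + n - k) * thetaTerm a b y n k
    · rw [mul_sum]
      refine sum_congr rfl fun k hk => ?_
      rw [thetaTerm_succ hab (Nat.lt_succ_iff.1 (mem_range.1 hk))]; ring
    · rw [ih]; ring

/-- The sum of the `j`-th and the `-j`-th term of the theta series. -/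
def thetaPair (a b y : R) (r : ℕ) : R := if r = 0 then 1 else (a ^ r + b ^ r) * y ^ r.choose 2

lemma sum_range_two_mul_add_one (f : ℕ → R) (n : ℕ) :
    ∑ k ∈ range (n + n + 1), f k =
      ∑ r ∈ range (n + 1), if r = 0 then f n else f (n + r) + f (n - r) := by
  rw [add_assoc, sum_range_add, ← sum_range_reflect, sum_range_succ', sum_range_succ',
    ← add_assoc, ← sum_add_distrib]
  simp only [add_zero, if_true, Nat.add_eq_zero_iff, one_ne_zero, and_false, if_false]
  congr 1
  refine sum_congr rfl fun r _ => ?_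
  rw [add_comm, Nat.sub_sub, add_comm 1 r]

lemma finite_triple_product_folded {a b y : R} (hy : IsNilpotent y) (hab : a * b = y) (n : ℕ) :
    ∑ r ∈ range (n + 1), qInv y (n - r) * qInv y (n + r) * thetaPair a b y r =
      qInv y (n + n) * ((∏ i ∈ range n, (1 + a * y ^ i)) * ∏ i ∈ range n, (1 + b * y ^ i)) := by
  rw [← finite_triple_product hy hab, sum_range_two_mul_add_one]
  refine sum_congr rfl fun r hr => ?_
  have hr := mem_range.1 hr
  rcases r with _ | r
  · simp [thetaPair, thetaTerm]
  · simp only [thetaPair, thetaTerm, Nat.add_eq_zero_iff, one_ne_zero, and_false, if_false]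
    rw [if_pos (by omega), if_neg (by omega), show n + n - (n + (r + 1)) = n - (r + 1) by omega,
      show n + (r + 1) - n = r + 1 by omega, show n - (n - (r + 1)) = r + 1 by omega,
      show n + n - (n - (r + 1)) = n + (r + 1) by omega]
    ring

/-- A finite form of the first Rogers–Ramanujan identity. -/
lemma finite_rogers_ramanujan {q : R} (hq : IsNilpotent q) (n : ℕ) :
    ∑ s ∈ range (n + 1), q ^ (s ^ 2) * qInv q (n - s) * qInv q s =
      ∑ r ∈ range (n + 1), qInv q (n - r) * qInv q (n + r) *
        (q ^ (r ^ 2) * (q ^ (r ^ 2) * thetaPair (-1) (-q) q r)) := by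
  have h0 : ∀ n, (if n = 0 then 1 else 0 : R) = ∑ r ∈ range (n + 1),
      qInv q (n - r) * qInv q (n + r) * thetaPair (-1) (-q) q r := by
    intro n
    rw [finite_triple_product_folded hq (by ring)]
    rcases n with _ | n
    · simp
    · rw [prod_range_succ']; simp
  refine bailey_step hq (fun n => ?_) n
  rw [← bailey_step hq h0, sum_range_succ']
  simp

lemma thetaPair_neg_sq_neg_cube (q : R) (r : ℕ) :
    thetaPair (-q ^ 2) (-q ^ 3) (q ^ 5) r =
      q ^ (r ^ 2) * (q ^ (r ^ 2) * thetaPair (-1) (-q) q r) := by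
  unfold thetaPair
  rcases r with _ | r
  · simp
  · simp only [Nat.add_eq_zero_iff, one_ne_zero, and_false, if_false]
    have h : (r + 1) ^ 2 = (r + 1) + 2 * (r + 1).choose 2 := by
      induction r with
      | zero => rfl
      | succ r ih => rw [choose_two_succ (r + 1)]; linarith
    rw [h, neg_pow (q ^ 2), neg_pow (q ^ 3), neg_pow q]
    ring

lemma mul_qInv_add {q t : R} (hq : IsNilpotent q) {n : ℕ} (ht : t * q ^ (n + 1) = 0) (d : ℕ) :
    t * qInv q (n + d) = t * qInv q n := by
  induction d with
  | zero => rfl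
  | succ d ih =>
    rw [← ih, qInv_eq_mul_qInv_succ hq (n + d), ← add_assoc]
    have : t * q ^ (n + d + 1) = 0 := by
      rw [show n + d + 1 = n + 1 + d by ring, pow_add, ← mul_assoc, ht, zero_mul]
    linear_combination qInv q (n + d + 1) * this

/-- The truncated series `∑ q ^ (s ^ 2 + m s) / (q; q)_s`. -/
noncomputable def rrSum (q : R) (N m : ℕ) : R :=
  ∑ s ∈ range (N + 1), q ^ (s ^ 2 + m * s) * qInv q s

lemma sum_qInv_mul_qInv_of_pow_eq_zero {q : R} {N e : ℕ} (hN : q ^ (N + 1) = 0) (he : 1 ≤ e)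
    (α : ℕ → R) (hα : ∀ r, q ^ r ∣ α r) :
    ∑ r ∈ range (N + 1), qInv (q ^ e) (N - r) * qInv (q ^ e) (N + r) * α r =
      qInv (q ^ e) N * (qInv (q ^ e) N * ∑ r ∈ range (N + 1), α r) := by
  have hy : IsNilpotent (q ^ e) := IsNilpotent.pow_of_pos ⟨_, hN⟩ (by omega)
  simp only [mul_sum]
  refine sum_congr rfl fun r hr => ?_
  obtain ⟨d, rfl⟩ := Nat.exists_eq_add_of_le (Nat.lt_succ_iff.1 (mem_range.1 hr))
  have h1 : qInv (q ^ e) (r + d + r) = qInv (q ^ e) (r + d) := by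
    have : (1 : R) * (q ^ e) ^ (r + d + 1) = 0 := by
      rw [one_mul, ← pow_mul]
      exact pow_eq_zero_of_le (Nat.le_mul_of_pos_left _ he) hN
    simpa using mul_qInv_add hy this r
  have h2 : α r * qInv (q ^ e) (d + r) = α r * qInv (q ^ e) d := by
    refine mul_qInv_add hy ?_ r
    obtain ⟨c, hc⟩ := hα r
    have h3 : q ^ r * (q ^ e) ^ (d + 1) = 0 := by
      rw [← pow_mul, ← pow_add]
      refine pow_eq_zero_of_le ?_ hN
      have := Nat.le_mul_of_pos_left (d + 1) he
      omega
    rw [hc, mul_right_comm, h3, zero_mul]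
  rw [h1, show r + d - r = d by omega]
  rw [add_comm d r] at h2
  linear_combination (-qInv (q ^ e) (r + d)) * h2

lemma rrSum_zero_eq {q : R} {N : ℕ} (hN : q ^ (N + 1) = 0) :
    rrSum q N 0 = qInv q N *
      ∑ r ∈ range (N + 1), q ^ (r ^ 2) * (q ^ (r ^ 2) * thetaPair (-1) (-q) q r) := by
  have hq : IsNilpotent q := ⟨_, hN⟩
  have h := finite_rogers_ramanujan hq N
  have hα (r : ℕ) : q ^ r ∣ q ^ (r ^ 2) * (q ^ (r ^ 2) * thetaPair (-1) (-q) q r) :=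
    (pow_dvd_pow q (Nat.le_self_pow two_ne_zero r)).mul_right _
  have h' := sum_qInv_mul_qInv_of_pow_eq_zero hN le_rfl _ hα
  rw [pow_one] at h'
  apply ((isUnit_qFac hq N).ringInverse).mul_left_cancel
  rw [← qInv, ← h', ← h, rrSum, mul_sum]
  refine sum_congr rfl fun s hs => ?_
  obtain ⟨d, rfl⟩ := Nat.exists_eq_add_of_le (Nat.lt_succ_iff.1 (mem_range.1 hs))
  have h2 : q ^ (s ^ 2) * qInv q (d + s) = q ^ (s ^ 2) * qInv q d := by
    refine mul_qInv_add hq ?_ s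
    rw [← pow_add]
    refine pow_eq_zero_of_le ?_ hN
    have := Nat.le_self_pow two_ne_zero s
    omega
  rw [add_comm d s] at h2
  rw [show s + d - s = d by omega, zero_mul, add_zero, ← h2]
  ring

lemma qInv_mul_sum_eq_prod {q : R} {N : ℕ} (hN : q ^ (N + 1) = 0) :
    qInv (q ^ 5) N *
      ∑ r ∈ range (N + 1), q ^ (r ^ 2) * (q ^ (r ^ 2) * thetaPair (-1) (-q) q r) =
    (∏ i ∈ range N, (1 - q ^ (5 * i + 2))) * ∏ i ∈ range N, (1 - q ^ (5 * i + 3)) := by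
  have hy : IsNilpotent (q ^ 5) := IsNilpotent.pow_of_pos ⟨_, hN⟩ (by omega)
  have h := finite_triple_product_folded hy (show -q ^ 2 * -q ^ 3 = q ^ 5 by ring) N
  simp only [thetaPair_neg_sq_neg_cube] at h
  have hα (r : ℕ) : q ^ r ∣ q ^ (r ^ 2) * (q ^ (r ^ 2) * thetaPair (-1) (-q) q r) :=
    (pow_dvd_pow q (Nat.le_self_pow two_ne_zero r)).mul_right _
  rw [sum_qInv_mul_qInv_of_pow_eq_zero hN (by norm_num) _ hα] at h
  have h1 : qInv (q ^ 5) (N + N) = qInv (q ^ 5) N := by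
    have : (1 : R) * (q ^ 5) ^ (N + 1) = 0 := by
      rw [one_mul, ← pow_mul]
      exact pow_eq_zero_of_le (by omega) hN
    simpa using mul_qInv_add hy this N
  rw [h1] at h
  refine ((isUnit_qFac hy N).ringInverse).mul_left_cancel (h.trans ?_)
  rw [← qInv]
  congr 2 <;> refine prod_congr rfl fun i _ => ?_ <;> ring

lemma qFac_five_mul (q : R) (N : ℕ) :
    qFac q (5 * N) = qFac (q ^ 5) N * ((∏ i ∈ range N, (1 - q ^ (5 * i + 2))) *
      ∏ i ∈ range N, (1 - q ^ (5 * i + 3))) *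
      ∏ i ∈ range N, (1 - q ^ (5 * i + 1)) * (1 - q ^ (5 * i + 4)) := by
  unfold qFac
  induction N with
  | zero => simp
  | succ N ih =>
    rw [show 5 * (N + 1) = 5 * N + 1 + 1 + 1 + 1 + 1 by ring]
    simp only [prod_range_succ, ih]
    ring

/-- The first Rogers–Ramanujan identity modulo `q ^ (N + 1)`. -/
lemma rrSum_zero_mul_prod {q : R} {N : ℕ} (hN : q ^ (N + 1) = 0) :
    rrSum q N 0 * ∏ i ∈ range N, (1 - q ^ (5 * i + 1)) * (1 - q ^ (5 * i + 4)) = 1 := by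
  have hq : IsNilpotent q := ⟨_, hN⟩
  have hy : IsNilpotent (q ^ 5) := IsNilpotent.pow_of_pos ⟨_, hN⟩ (by omega)
  have h1 : qInv q (5 * N) = qInv q N := by
    have := mul_qInv_add (t := 1) hq (by rw [one_mul, hN]) (4 * N)
    rwa [one_mul, one_mul, show N + 4 * N = 5 * N by ring] at this
  have h2 := qInv_mul_qFac hq (5 * N)
  rw [h1, qFac_five_mul, ← qInv_mul_sum_eq_prod hN] at h2
  rw [rrSum_zero_eq hN]
  refine Eq.trans ?_ h2
  linear_combination (-qInv q N * (∑ r ∈ range (N + 1), q ^ (r ^ 2) *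
    (q ^ (r ^ 2) * thetaPair (-1) (-q) q r)) *
    ∏ i ∈ range N, (1 - q ^ (5 * i + 1)) * (1 - q ^ (5 * i + 4))) * qInv_mul_qFac hy N

lemma rrSum_eq_add {q : R} {N : ℕ} (hN : q ^ (N + 1) = 0) (m : ℕ) :
    rrSum q N m = rrSum q N (m + 1) + q ^ (m + 1) * rrSum q N (m + 2) := by
  have hq : IsNilpotent q := ⟨_, hN⟩
  have h1 : rrSum q N m - rrSum q N (m + 1) =
      ∑ s ∈ range (N + 1), q ^ (s ^ 2 + m * s) * ((1 - q ^ s) * qInv q s) := by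
    rw [rrSum, rrSum, ← sum_sub_distrib]
    refine sum_congr rfl fun s _ => ?_
    ring
  have h2 : q ^ (m + 1) * rrSum q N (m + 2) =
      ∑ s ∈ range N, q ^ (m + 1) * (q ^ (s ^ 2 + (m + 2) * s) * qInv q s) := by
    rw [rrSum, mul_sum, sum_range_succ, add_eq_left, ← mul_assoc, ← pow_add,
      pow_eq_zero_of_le ?_ hN, zero_mul]
    nlinarith
  rw [← sub_eq_iff_eq_add', h1, h2, sum_range_succ']
  simp only [pow_zero, sub_self, zero_mul, mul_zero, add_zero]
  refine sum_congr rfl fun s _ => ?_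
  rw [← qInv_eq_mul_qInv_succ hq]
  ring

lemma rrSum_eq_one {q : R} {N m : ℕ} (hN : q ^ (N + 1) = 0) (hm : N ≤ m) : rrSum q N m = 1 := by
  rw [rrSum, sum_range_succ', sum_eq_zero]
  · simp
  · intro s _
    rw [pow_eq_zero_of_le ?_ hN, zero_mul]
    nlinarith

lemma eq_rrSum_of_recurrence {q : R} {N : ℕ} (hN : q ^ (N + 1) = 0) {f : ℕ → R}
    (hf : ∀ m, f m = f (m + 1) + q ^ (m + 1) * f (m + 2)) (hf1 : ∀ m, N ≤ m → f m = 1) (m : ℕ) :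
    f m = rrSum q N m := by
  suffices h : ∀ k m, N ≤ m + k → f m = rrSum q N m from h N m (by omega)
  intro k
  induction k with
  | zero => intro m hm; rw [hf1 m (by omega), rrSum_eq_one hN (by omega)]
  | succ k ih =>
    intro m hm
    rw [hf, rrSum_eq_add hN, ih (m + 1) (by omega), ih (m + 2) (by omega)]

end QSeries

section Counting

/-- The number of partitions of `n`, as multisets of positive integers, satisfying `P`. -/
noncomputable def partCount (P : Multiset ℕ → Prop) (n : ℕ) : ℕ :=
  {s : Multiset ℕ | s.sum = n ∧ 0 ∉ s ∧ P s}.ncard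

lemma card_partition_eq_partCount (P : Multiset ℕ → Prop) (n : ℕ) :
    Nat.card {p : n.Partition // P p.parts} = partCount P n := by
  rw [partCount, ← Nat.card_coe_set_eq]
  refine Nat.card_congr
    { toFun := fun p => ⟨p.1.parts, p.1.parts_sum, fun h => (p.1.parts_pos h).ne' rfl, p.2⟩
      invFun := fun s => ⟨⟨s.1, fun {i} hi => Nat.pos_of_ne_zero (fun h => s.2.2.1 (h ▸ hi)),
        s.2.1⟩, s.2.2.2⟩
      left_inv := fun _ => rfl
      right_inv := fun _ => rfl }

lemma finite_partCount (P : Multiset ℕ → Prop) (n : ℕ) :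
    {s : Multiset ℕ | s.sum = n ∧ 0 ∉ s ∧ P s}.Finite := by
  refine (Set.finite_range (fun p : n.Partition => p.parts)).subset ?_
  rintro s ⟨h1, h2, -⟩
  exact ⟨⟨s, fun {i} hi => Nat.pos_of_ne_zero (fun h => h2 (h ▸ hi)), h1⟩, rfl⟩

lemma partCount_congr {P Q : Multiset ℕ → Prop} {n : ℕ}
    (h : ∀ s : Multiset ℕ, s.sum = n → 0 ∉ s → (P s ↔ Q s)) : partCount P n = partCount Q n := by
  unfold partCount
  congr 1
  ext s
  simp only [Set.mem_ofPred_eq]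
  exact and_congr_right fun h1 => and_congr_right fun h2 => h s h1 h2

/-- Splitting partitions according to whether `k` is a part. -/
lemma partCount_split (P : Multiset ℕ → Prop) {k : ℕ} (hk : 1 ≤ k) (n : ℕ) :
    partCount P n = partCount (fun s => P s ∧ k ∉ s) n +
      if k ≤ n then partCount (fun s => P (k ::ₘ s)) (n - k) else 0 := by
  have h1 : {s : Multiset ℕ | s.sum = n ∧ 0 ∉ s ∧ P s} =
      {s | s.sum = n ∧ 0 ∉ s ∧ P s ∧ k ∉ s} ∪ {s | s.sum = n ∧ 0 ∉ s ∧ P s ∧ k ∈ s} := by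
    ext s
    simp only [Set.mem_ofPred_eq, Set.mem_union]
    tauto
  rw [partCount, h1, Set.ncard_union_eq ?_ (finite_partCount _ n) (finite_partCount _ n),
    ← partCount]
  · congr 1
    split_ifs with hkn
    · rw [partCount, ← Set.ncard_image_of_injective
        {s : Multiset ℕ | s.sum = n - k ∧ 0 ∉ s ∧ P (k ::ₘ s)}
        fun _ _ h => (Multiset.cons_inj_right k).1 h]
      congr 1
      ext s
      simp only [Set.mem_ofPred_eq, Set.mem_image]
      constructor
      · rintro ⟨h1, h2, h3, h4⟩
        obtain ⟨t, rfl⟩ := Multiset.exists_cons_of_mem h4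
        rw [Multiset.sum_cons] at h1
        exact ⟨t, ⟨by omega, fun h => h2 (Multiset.mem_cons_of_mem h), h3⟩, rfl⟩
      · rintro ⟨t, ⟨h1, h2, h3⟩, rfl⟩
        refine ⟨by rw [Multiset.sum_cons]; omega, ?_, h3, Multiset.mem_cons_self k t⟩
        rw [Multiset.mem_cons]
        rintro (h | h)
        · omega
        · exact h2 h
    · rw [Set.ncard_eq_zero (finite_partCount _ n)]
      ext s
      simp only [Set.mem_ofPred_eq, Set.mem_empty_iff_false, iff_false]
      rintro ⟨h1, -, -, h4⟩
      have := Multiset.le_sum_of_mem h4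
      omega
  · rw [Set.disjoint_left]
    rintro s ⟨-, -, -, h⟩ ⟨-, -, -, h'⟩
    exact h h'

/-- The generating function of the partitions satisfying `P`. -/
noncomputable def partGen (P : Multiset ℕ → Prop) : PowerSeries ℤ :=
  PowerSeries.mk fun n => (partCount P n : ℤ)

lemma partGen_split (P : Multiset ℕ → Prop) {k : ℕ} (hk : 1 ≤ k) :
    partGen P = partGen (fun s => P s ∧ k ∉ s) +
      PowerSeries.X ^ k * partGen (fun s => P (k ::ₘ s)) := by
  ext n
  rw [map_add, PowerSeries.coeff_X_pow_mul']
  simp only [partGen, PowerSeries.coeff_mk]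
  rw [partCount_split P hk]
  push_cast
  rfl

lemma partGen_congr {P Q : Multiset ℕ → Prop} (h : ∀ s : Multiset ℕ, 0 ∉ s → (P s ↔ Q s)) :
    partGen P = partGen Q := by
  unfold partGen
  congr 1
  ext n
  rw [partCount_congr fun s _ hs => h s hs]

lemma partCount_zero {P : Multiset ℕ → Prop} (hP : P 0) : partCount P 0 = 1 := by
  rw [partCount, Set.ncard_eq_one]
  refine ⟨0, ?_⟩
  ext s
  simp only [Set.mem_ofPred_eq, Set.mem_singleton_iff]
  constructor
  · rintro ⟨h1, h2, -⟩
    refine Multiset.eq_zero_of_forall_notMem fun a ha => h2 ?_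
    have := Multiset.le_sum_of_mem ha
    obtain rfl : a = 0 := by omega
    exact ha
  · rintro rfl
    simp [hP]

lemma partCount_eq_zero {P : Multiset ℕ → Prop} {n : ℕ} (hn : n ≠ 0)
    (hP : ∀ s : Multiset ℕ, P s → ∀ i ∈ s, n < i) : partCount P n = 0 := by
  rw [partCount, Set.ncard_eq_zero (finite_partCount _ n)]
  ext s
  simp only [Set.mem_ofPred_eq, Set.mem_empty_iff_false, iff_false]
  rintro ⟨h1, -, h3⟩
  rcases Multiset.empty_or_exists_mem s with rfl | ⟨a, ha⟩
  · exact hn (by simpa using h1.symm)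
  · have := Multiset.le_sum_of_mem ha
    have := hP s h3 a ha
    omega

/-- If the partitions satisfying `P` have all parts larger than `N`, then the generating function
is `1` modulo `X ^ (N + 1)`. -/
lemma X_pow_dvd_partGen_sub_one {P : Multiset ℕ → Prop} {N : ℕ} (h0 : P 0)
    (hP : ∀ s : Multiset ℕ, P s → ∀ i ∈ s, N < i) : PowerSeries.X ^ (N + 1) ∣ partGen P - 1 := by
  rw [PowerSeries.X_pow_dvd_iff]
  intro n hn
  rw [map_sub, PowerSeries.coeff_one, partGen, PowerSeries.coeff_mk]
  split_ifs with h
  · rw [h, partCount_zero h0]; simp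
  · rw [partCount_eq_zero h fun s hs i hi => by have := hP s hs i hi; omega]; simp

lemma partGen_insert (S : Finset ℕ) {k : ℕ} (hk : 1 ≤ k) (hkS : k ∉ S) :
    (1 - PowerSeries.X ^ k) * partGen (fun s => ∀ i ∈ s, i ∈ insert k S) =
      partGen (fun s => ∀ i ∈ s, i ∈ S) := by
  have h := partGen_split (fun s => ∀ i ∈ s, i ∈ insert k S) hk
  have h1 : partGen (fun s => (∀ i ∈ s, i ∈ insert k S) ∧ k ∉ s) =
      partGen (fun s => ∀ i ∈ s, i ∈ S) := by
    refine partGen_congr fun s _ => ⟨fun h i hi => ?_, fun h => ⟨fun i hi => ?_, fun hi => ?_⟩⟩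
    · exact mem_of_mem_insert_of_ne (h.1 i hi) fun hik => h.2 (hik ▸ hi)
    · exact mem_insert_of_mem (h i hi)
    · exact hkS (h k hi)
  have h2 : partGen (fun s => ∀ i ∈ k ::ₘ s, i ∈ insert k S) =
      partGen (fun s => ∀ i ∈ s, i ∈ insert k S) :=
    partGen_congr fun s _ => by simp
  rw [h1, h2] at h
  linear_combination h

lemma prod_mul_partGen (S : Finset ℕ) (hS : 0 ∉ S) :
    (∏ k ∈ S, (1 - PowerSeries.X ^ k)) * partGen (fun s => ∀ i ∈ s, i ∈ S) = 1 := by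
  induction S using Finset.induction_on with
  | empty =>
    simp only [prod_empty, one_mul]
    ext n
    rw [partGen, PowerSeries.coeff_mk, PowerSeries.coeff_one]
    split_ifs with h
    · rw [h, partCount_zero (by simp)]; rfl
    · rw [partCount_eq_zero h fun s hs i hi => absurd (hs i hi) (notMem_empty i)]; rfl
  | insert k S hk ih =>
    rw [prod_insert hk, mul_comm (1 - _), mul_assoc, partGen_insert S ?_ hk, ih]
    · exact fun h => hS (mem_insert_of_mem h)
    · exact Nat.pos_of_ne_zero fun h => hS (h ▸ mem_insert_self k S)

/-- All parts exceed `m`, and the parts are distinct with no two consecutive. -/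
def IsGapPartition (m : ℕ) (s : Multiset ℕ) : Prop :=
  (∀ i ∈ s, m < i) ∧ ∀ i, 1 ≤ i → s.count i + s.count (i + 1) ≤ 1

lemma isGapPartition_and_notMem_iff (m : ℕ) (s : Multiset ℕ) :
    IsGapPartition m s ∧ m + 1 ∉ s ↔ IsGapPartition (m + 1) s := by
  constructor
  · rintro ⟨⟨h1, h2⟩, h3⟩
    refine ⟨fun i hi => lt_of_le_of_ne (h1 i hi) fun h => h3 (h ▸ hi), h2⟩
  · rintro ⟨h1, h2⟩
    exact ⟨⟨fun i hi => (Nat.lt_succ_self m).trans (h1 i hi), h2⟩, fun h => (h1 _ h).false⟩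

lemma isGapPartition_cons_iff (m : ℕ) (s : Multiset ℕ) :
    IsGapPartition m ((m + 1) ::ₘ s) ↔ IsGapPartition (m + 2) s := by
  constructor
  · rintro ⟨h1, h2⟩
    have h3 := h2 (m + 1) (by omega)
    simp only [Multiset.count_cons] at h2 h3
    simp only [if_true] at h3
    have h4 : s.count (m + 1) = 0 := by omega
    have h5 : s.count (m + 1 + 1) = 0 := by omega
    rw [Multiset.count_eq_zero] at h4 h5
    refine ⟨fun i hi => ?_, fun i hi => ?_⟩
    · have := h1 i (Multiset.mem_cons_of_mem hi)
      have h6 : i ≠ m + 1 := fun h => h4 (h ▸ hi)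
      have h7 : i ≠ m + 1 + 1 := fun h => h5 (h ▸ hi)
      omega
    · have := h2 i hi
      omega
  · rintro ⟨h1, h2⟩
    have h3 : ∀ i ≤ m + 2, s.count i = 0 := fun i hi =>
      Multiset.count_eq_zero.2 fun h => by have := h1 i h; omega
    refine ⟨fun i hi => ?_, fun i hi => ?_⟩
    · rcases Multiset.mem_cons.1 hi with rfl | hi
      · omega
      · have := h1 i hi
        omega
    · simp only [Multiset.count_cons]
      rcases le_or_gt i (m + 1) with h | h
      · rw [h3 i (by omega), h3 (i + 1) (by omega)]
        split_ifs <;> omega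
      · rw [if_neg (by omega), if_neg (by omega)]
        exact h2 i hi

lemma partGen_isGapPartition (m : ℕ) :
    partGen (IsGapPartition m) = partGen (IsGapPartition (m + 1)) +
      PowerSeries.X ^ (m + 1) * partGen (IsGapPartition (m + 2)) := by
  rw [partGen_split (IsGapPartition m) (Nat.succ_pos m)]
  simp only [isGapPartition_and_notMem_iff, isGapPartition_cons_iff]

lemma prod_filter_mod_five {R : Type*} [CommRing R] (q : R) (N : ℕ) :
    ∏ k ∈ range (5 * N) with k % 5 = 1 ∨ k % 5 = 4, (1 - q ^ k) =
      ∏ i ∈ range N, (1 - q ^ (5 * i + 1)) * (1 - q ^ (5 * i + 4)) := by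
  rw [prod_filter]
  induction N with
  | zero => simp
  | succ N ih =>
    rw [show 5 * (N + 1) = 5 * N + 1 + 1 + 1 + 1 + 1 by ring]
    simp only [prod_range_succ, ih]
    rw [if_neg (by omega), if_pos (by omega), if_neg (by omega), if_neg (by omega),
      if_pos (by omega)]
    ring

/-- Modulo `X ^ (N + 1)`, the generating functions of both kinds of partitions agree. -/
lemma X_pow_dvd_partGen_sub_partGen (N : ℕ) : PowerSeries.X ^ (N + 1) ∣
    partGen (fun s => ∀ i ∈ s, i ∈ (range (5 * N)).filter fun k => k % 5 = 1 ∨ k % 5 = 4) -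
      partGen (IsGapPartition 0) := by
  set I : Ideal (PowerSeries ℤ) := Ideal.span {PowerSeries.X ^ (N + 1)}
  let φ := Ideal.Quotient.mk I
  have hφ (f g : PowerSeries ℤ) : φ f = φ g ↔ PowerSeries.X ^ (N + 1) ∣ f - g := by
    rw [Ideal.Quotient.eq, Ideal.mem_span_singleton]
  rw [← hφ]
  have hN : φ PowerSeries.X ^ (N + 1) = 0 := by
    rw [← map_pow, ← map_zero φ, hφ, sub_zero]
  have hgap : φ (partGen (IsGapPartition 0)) = rrSum (φ PowerSeries.X) N 0 := by
    refine eq_rrSum_of_recurrence hN (f := fun m => φ (partGen (IsGapPartition m)))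
      (fun m => ?_) (fun m hm => ?_) 0
    · rw [partGen_isGapPartition m, map_add, map_mul, map_pow]
    · rw [← map_one φ, hφ]
      exact X_pow_dvd_partGen_sub_one (by simp [IsGapPartition])
        fun s hs i hi => hm.trans_lt (hs.1 i hi)
  have hmod := congrArg φ (prod_mul_partGen
    ((range (5 * N)).filter fun k => k % 5 = 1 ∨ k % 5 = 4) (by simp))
  rw [prod_filter_mod_five, map_mul, map_one, map_prod] at hmod
  simp only [map_mul, map_sub, map_one, map_pow] at hmod
  rw [hgap]
  linear_combination (-φ (partGen fun s => ∀ i ∈ s,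
    i ∈ (range (5 * N)).filter fun k => k % 5 = 1 ∨ k % 5 = 4)) * rrSum_zero_mul_prod hN +
    rrSum (φ PowerSeries.X) N 0 * hmod

end Counting

end RogersRamanujan

open RogersRamanujan in
theorem rogers_ramanujan_first_combinatorial (n : ℕ) :
    Nat.card {p : n.Partition //
        ∀ i ∈ p.parts, ¬(i % 5 = 0 ∨ i % 5 = 2 ∨ i % 5 = 3)} =
      Nat.card {p : n.Partition //
        ∀ i : ℕ, 1 ≤ i → p.parts.count i + p.parts.count (i + 1) ≤ 1} := by
  rw [card_partition_eq_partCount (fun s => ∀ i ∈ s, ¬(i % 5 = 0 ∨ i % 5 = 2 ∨ i % 5 = 3)),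
    card_partition_eq_partCount (fun s => ∀ i : ℕ, 1 ≤ i → s.count i + s.count (i + 1) ≤ 1)]
  have h := PowerSeries.X_pow_dvd_iff.1 (X_pow_dvd_partGen_sub_partGen n) n (Nat.lt_succ_self n)
  rw [map_sub, sub_eq_zero, partGen, partGen, PowerSeries.coeff_mk, PowerSeries.coeff_mk,
    Nat.cast_inj] at h
  convert h using 1
  · refine partCount_congr fun s hs h0 => forall₂_congr fun i hi => ?_
    have h1 := Multiset.le_sum_of_mem hi
    have h2 : i ≠ 0 := fun h => h0 (h ▸ hi)
    rw [mem_filter, mem_range]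
    omega
  · refine partCount_congr fun s _ h0 => ?_
    refine (and_iff_right fun i hi => ?_).symm
    exact Nat.pos_of_ne_zero fun h => h0 (h ▸ hi)
end
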